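/- arXiv:1206.5728 — 4 statements merged into one kernel-verified Lean document; each statement's English description precedes it below -/
import Mathlib

section
/- Every element ψ of the centralizer C(ρ) of the Nielsen automorphism ρ in Aut(F_n) maps the subgroup H onto itself, i.e. ψ(H) = H, where H is the subgroup of F_n generated by aba⁻¹, b, c₁, …, c_{n−2}. -/
/-! The free group `F m` of rank `m + 2` has basis `{a, b, c₁, …, c_m}` where
`a = of 0`, `b = of 1` and `cᵢ = of (i + 1)`. -/

abbrev F (m : ℕ) := FreeGroup (Fin (m + 2))

/-- `H`: the subgroup of `F_n` generated by `aba⁻¹, b, c₁, …, c_{n-2}`. -/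
def Hsub (m : ℕ) : Subgroup (F m) :=
  Subgroup.closure
    ({FreeGroup.of 0 * FreeGroup.of 1 * (FreeGroup.of 0)⁻¹, FreeGroup.of 1} ∪
      {x | ∃ j : Fin (m + 2), 2 ≤ (j : ℕ) ∧ x = FreeGroup.of j})

open HNNExtension HNNExtension.NormalWord

/-- In a free group, the centralizer of a basis element is the cyclic subgroup it generates. -/
theorem FreeGroup.mem_zpowers_of_commute {α : Type*} [DecidableEq α] {x : α} {u : FreeGroup α}
    (h : Commute (FreeGroup.of x) u) : u ∈ Subgroup.zpowers (FreeGroup.of x) := by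
  induction hn : u.toWord.length using Nat.strong_induction_on generalizing u with
  | _ n ih =>
    have strip : ∀ g ∈ Subgroup.zpowers (FreeGroup.of x), ∀ l, g⁻¹ * u = FreeGroup.mk l →
        l.length < n → u ∈ Subgroup.zpowers (FreeGroup.of x) := by
      intro g hg l hl hlt
      have hcomm : Commute (FreeGroup.of x) g := by
        obtain ⟨k, rfl⟩ := hg
        exact (Commute.refl _).zpow_right k
      have hle : (g⁻¹ * u).toWord.length ≤ l.length := by
        rw [hl]; exact FreeGroup.norm_mk_le
      exact (Subgroup.mul_mem_cancel_left _ (inv_mem hg)).1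
        (ih _ (hle.trans_lt hlt) (hcomm.inv_right.mul_right h) rfl)
    have hx := Subgroup.mem_zpowers (FreeGroup.of x)
    have hu : u = FreeGroup.mk u.toWord := FreeGroup.mk_toWord.symm
    rcases hL : u.toWord with _ | ⟨⟨y, s⟩, l⟩
    · rw [FreeGroup.toWord_eq_nil_iff.1 hL]; exact one_mem _
    · rw [hL] at hu hn
      have hlt : l.length < n := by simp at hn; omega
      by_cases hxy : y = x
      · subst hxy
        cases s
        · refine strip _ (inv_mem hx) l ?_ hlt
          rw [hu, FreeGroup.of, FreeGroup.inv_mk, FreeGroup.inv_mk, FreeGroup.mul_mk]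
          exact Quot.sound (.cons_not (b := true))
        · refine strip _ hx l ?_ hlt
          rw [hu, FreeGroup.of, FreeGroup.inv_mk, FreeGroup.mul_mk]
          exact Quot.sound (.cons_not (b := false))
      · have hred : FreeGroup.IsReduced ((x, true) :: (y, s) :: l) := by
          rw [FreeGroup.isReduced_cons_cons, ← hL]
          exact ⟨fun e => absurd e.symm hxy, FreeGroup.isReduced_toWord⟩
        have hword : (FreeGroup.of x * u).toWord = (x, true) :: (y, s) :: l := by
          rw [FreeGroup.toWord_mul, FreeGroup.toWord_of, hL]
          exact hred.reduce_eq
        have hsub := FreeGroup.toWord_mul_sublist u (FreeGroup.of x)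
        rw [← h.eq, hword, hL, FreeGroup.toWord_of] at hsub
        have heq := hsub.eq_of_length (by simp)
        simp only [List.cons_append, List.cons.injEq, Prod.mk.injEq] at heq
        exact absurd heq.1.1.symm hxy

section TrivialHNN

variable {G : Type*} [Group G]

/-- For trivial associated subgroups, the product of a word determines the word as soon as it has
no subword `t ^ u * 1 * t ^ (-u)`. -/
theorem HNNExtension.prod_injective_of_bot {φ : (⊥ : Subgroup G) ≃* (⊥ : Subgroup G)}
    {w w' : ReducedWord G ⊥ ⊥} (h : w.prod φ = w'.prod φ) :
    w.head = w'.head ∧ w.toList = w'.toList := by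
  let d : TransversalPair G (⊥ : Subgroup G) ⊥ :=
    { set := fun _ => Set.univ
      compl := fun u => by
        have : toSubgroup (⊥ : Subgroup G) ⊥ u = ⊥ := by simp [toSubgroup]
        rw [this]
        exact Subgroup.isComplement_singleton_univ (g := 1) }
  have := NormalWord.prod_injective φ d
    (a₁ := ⟨w, fun _ _ _ => Set.mem_univ _⟩) (a₂ := ⟨w', fun _ _ _ => Set.mem_univ _⟩) h
  exact ⟨congrArg (fun v => v.head) this, congrArg (fun v => v.toList) this⟩

/-- The effect on words of the substitution `t ↦ t * b`, where a word is given by its head and its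
list of pairs `(u, h)`, each standing for `t ^ u * h`. -/
def substWord (b : G) : G → List (ℤˣ × G) → G × List (ℤˣ × G)
  | g, [] => (g, [])
  | g, (u, h) :: l =>
    (if u = 1 then g else g * b⁻¹,
      (u, (substWord b (if u = 1 then b * h else h) l).1) ::
        (substWord b (if u = 1 then b * h else h) l).2)

/-- The element of the HNN extension represented by a word. -/
def wordProd (φ : (⊥ : Subgroup G) ≃* (⊥ : Subgroup G)) (g : G) (l : List (ℤˣ × G)) :
    HNNExtension G ⊥ ⊥ φ :=
  of g * (l.map (fun x => t ^ (x.1 : ℤ) * of x.2)).prod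

variable {φ : (⊥ : Subgroup G) ≃* (⊥ : Subgroup G)} {b : G}

@[simp]
theorem wordProd_nil (g : G) : wordProd φ g [] = of g := by simp [wordProd]

@[simp]
theorem wordProd_cons (g h : G) (u : ℤˣ) (l : List (ℤˣ × G)) :
    wordProd φ g ((u, h) :: l) = of g * t ^ (u : ℤ) * wordProd φ h l := by
  simp [wordProd, mul_assoc]

theorem wordProd_mul (g h : G) (l : List (ℤˣ × G)) :
    wordProd φ (g * h) l = of g * wordProd φ h l := by
  simp [wordProd, mul_assoc]

theorem wordProd_substWord {σ : HNNExtension G ⊥ ⊥ φ →* HNNExtension G ⊥ ⊥ φ}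
    (hσt : σ t = t * of b) (hσ : ∀ g, σ (of g) = of g) (l : List (ℤˣ × G)) (g : G) :
    wordProd φ (substWord b g l).1 (substWord b g l).2 = σ (wordProd φ g l) := by
  induction l generalizing g with
  | nil => simp [substWord, hσ]
  | cons p l ih =>
    obtain ⟨u, h⟩ := p
    rcases Int.units_eq_one_or u with rfl | rfl
    · simp [substWord, ih, hσ, hσt, wordProd_mul, mul_assoc]
    · simp [substWord, ih, hσ, hσt, mul_assoc]

theorem isChain_substWord (l : List (ℤˣ × G)) (u : ℤˣ) (g : G)
    (hl : ((u, g) :: l).IsChain (fun x y => x.2 = 1 → x.1 = y.1)) :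
    ((u, (substWord b (if u = 1 then b * g else g) l).1) ::
      (substWord b (if u = 1 then b * g else g) l).2).IsChain
        (fun x y => x.2 = 1 → x.1 = y.1) := by
  induction l generalizing u g with
  | nil => simp [substWord]
  | cons p l ih =>
    obtain ⟨v, h⟩ := p
    rw [List.isChain_cons_cons] at hl
    rw [substWord, List.isChain_cons_cons]
    refine ⟨?_, ih v h hl.2⟩
    have := hl.1
    rcases Int.units_eq_one_or u with rfl | rfl <;>
      rcases Int.units_eq_one_or v with rfl | rfl <;> simp_all

/-- A word fixed by `t ↦ t * b` represents an element of every subgroup containing the base group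
and the conjugates by `t` of the centralizer of `b`. -/
theorem wordProd_mem_of_substWord_eq {K : Subgroup (HNNExtension G ⊥ ⊥ φ)} (hb : b ≠ 1)
    (hK : ∀ g, of g ∈ K) (hKt : ∀ g, Commute b g → t * of g * t⁻¹ ∈ K)
    (l : List (ℤˣ × G)) (g : G) :
    (substWord b g l = (g, l) → wordProd φ g l ∈ K) ∧
      (substWord b (b * g) l = (g, l) → t * wordProd φ g l ∈ K) := by
  induction l generalizing g with
  | nil => exact ⟨fun _ => by simpa using hK g, fun h => by simp [substWord, hb] at h⟩
  | cons p l ih =>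
    obtain ⟨u, h⟩ := p
    rcases Int.units_eq_one_or u with rfl | rfl
    · refine ⟨fun hs => ?_, fun hs => by simp [substWord, hb] at hs⟩
      simp only [substWord, if_true, Prod.mk.injEq, List.cons.injEq, true_and] at hs
      have := mul_mem (hK g) ((ih h).2 (Prod.ext hs.1 hs.2))
      simpa [mul_assoc] using this
    · refine ⟨fun hs => by simp [substWord, hb] at hs, fun hs => ?_⟩
      simp only [substWord, show (-1 : ℤˣ) ≠ 1 by decide, if_false, Prod.mk.injEq,
        List.cons.injEq, true_and] at hs
      have := mul_mem (hKt g (mul_inv_eq_iff_eq_mul.1 hs.1)) ((ih h).1 (Prod.ext hs.2.1 hs.2.2))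
      simpa [mul_assoc] using this

theorem mem_of_fixed {σ : HNNExtension G ⊥ ⊥ φ →* HNNExtension G ⊥ ⊥ φ}
    (hσt : σ t = t * of b) (hσ : ∀ g, σ (of g) = of g) {K : Subgroup (HNNExtension G ⊥ ⊥ φ)}
    (hb : b ≠ 1) (hK : ∀ g, of g ∈ K) (hKt : ∀ g, Commute b g → t * of g * t⁻¹ ∈ K)
    {x : HNNExtension G ⊥ ⊥ φ} (hx : σ x = x) : x ∈ K := by
  obtain ⟨d⟩ := TransversalPair.nonempty G (⊥ : Subgroup G) ⊥
  obtain ⟨⟨⟨g, l, chain⟩, _⟩, hw⟩ := (NormalWord.equiv φ d).symm.surjective x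
  obtain rfl : wordProd φ g l = x := hw
  have hrel : (fun x y : ℤˣ × G => x.2 ∈ toSubgroup ⊥ ⊥ x.1 → x.1 = y.1) =
      fun x y => x.2 = 1 → x.1 = y.1 := by
    funext x y
    simp [toSubgroup, Subgroup.mem_bot]
  have chain' : (substWord b g l).2.IsChain (fun x y => x.2 = 1 → x.1 = y.1) := by
    rw [hrel] at chain
    cases l with
    | nil => simp [substWord]
    | cons p l => exact isChain_substWord l p.1 p.2 chain
  rw [← wordProd_substWord hσt hσ] at hx
  obtain ⟨h1, h2⟩ := HNNExtension.prod_injective_of_bot (φ := φ)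
    (w := ⟨(substWord b g l).1, (substWord b g l).2, hrel ▸ chain'⟩) (w' := ⟨g, l, chain⟩) hx
  exact (wordProd_mem_of_substWord_eq hb hK hKt l g).1 (Prod.ext h1 h2)

end TrivialHNN

/-- The fixed subgroup of the Nielsen automorphism is `H`. -/
theorem mem_Hsub_iff_fixed (m : ℕ) (ρ : MulAut (F m))
    (hρa : ρ (FreeGroup.of 0) = FreeGroup.of 0 * FreeGroup.of 1)
    (hρ : ∀ i : Fin (m + 2), i ≠ 0 → ρ (FreeGroup.of i) = FreeGroup.of i) (w : F m) :
    w ∈ Hsub m ↔ ρ w = w := by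
  have hb : ρ (FreeGroup.of 1) = FreeGroup.of 1 := hρ 1 (by simp)
  constructor
  · intro hw
    refine MonoidHom.eqOn_closure (f := ρ.toMonoidHom) (g := MonoidHom.id (F m)) ?_ hw
    rintro x ((rfl | rfl) | ⟨j, hj, rfl⟩)
    · simp [hρa, hb]
    · simpa using hb
    · exact hρ j (by rintro rfl; simp at hj)
  · intro hw
    let G := FreeGroup (Fin (m + 1))
    let T := HNNExtension G ⊥ ⊥ (MulEquiv.refl _)
    let ι : G →* F m := FreeGroup.lift fun i => FreeGroup.of i.succ
    let e : F m →* T :=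
      FreeGroup.lift (Fin.cases t fun i => of (FreeGroup.of i))
    let f : T →* F m := HNNExtension.lift ι (FreeGroup.of 0) (by
      rintro ⟨a, ha⟩
      obtain rfl := Subgroup.mem_bot.1 ha
      simp)
    have he0 : e (FreeGroup.of 0) = t := by simp [e]
    have hes : ∀ i : Fin (m + 1), e (FreeGroup.of i.succ) = of (FreeGroup.of i) := by
      intro i; simp [e]
    have hft : f t = FreeGroup.of 0 := HNNExtension.lift_t ..
    have hfo : ∀ g, f (of g) = ι g := fun g => HNNExtension.lift_of ..
    have hι : ∀ i, ι (FreeGroup.of i) = FreeGroup.of i.succ := fun i => FreeGroup.lift_apply_of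
    have hfe : ∀ x, f (e x) = x := by
      refine DFunLike.congr_fun (f := f.comp e) (g := MonoidHom.id _) (FreeGroup.ext_hom _ _ ?_)
      refine Fin.cases ?_ fun i => ?_
      · simp [he0, hft]
      · simp [hes, hfo, hι]
    have hmem : ∀ i : Fin (m + 1), FreeGroup.of i.succ ∈ Hsub m := by
      refine Fin.cases ?_ fun i => ?_
      · exact Subgroup.subset_closure (Or.inl (Or.inr rfl))
      · exact Subgroup.subset_closure (Or.inr ⟨_, by simp, rfl⟩)
    let σ : T →* T := (e.comp ρ.toMonoidHom).comp f
    have hσt : σ t = t * of (FreeGroup.of 0) := by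
      have : e (FreeGroup.of 1) = of (FreeGroup.of 0) := hes 0
      simp [σ, hft, hρa, he0, this]
    have hσ : ∀ g, σ (of g) = of g := by
      refine DFunLike.congr_fun (f := σ.comp of) (g := of) (FreeGroup.ext_hom _ _ fun i => ?_)
      simp [σ, hfo, hι, hρ _ (Fin.succ_ne_zero i), hes]
    have key : e w ∈ (Hsub m).comap f := by
      refine mem_of_fixed hσt hσ (FreeGroup.of_ne_one _) (fun g => ?_) (fun g hg => ?_) ?_
      · rw [Subgroup.mem_comap, hfo]
        have : ι.range ≤ Hsub m := by
          refine FreeGroup.range_lift_le ?_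
          rintro _ ⟨i, rfl⟩
          exact hmem i
        exact this ⟨g, rfl⟩
      · obtain ⟨k, rfl⟩ := FreeGroup.mem_zpowers_of_commute hg
        have : (FreeGroup.of 0 * FreeGroup.of 1 * (FreeGroup.of 0)⁻¹ : F m) ∈ Hsub m :=
          Subgroup.subset_closure (Or.inl (Or.inl rfl))
        simpa [hft, hfo, hι, conj_zpow] using zpow_mem this k
      · simp [σ, hfe, hw]
    simpa [hfe] using key

/-- every element `ψ` of the centralizer of the Nielsen automorphism
`ρ : a ↦ ab, b ↦ b, cᵢ ↦ cᵢ` maps the subgroup `H = ⟨aba⁻¹, b, c₁, …, c_{n-2}⟩`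
onto itself. -/
theorem nielsen_centralizer_preserves_H
    (m : ℕ) (ρ : MulAut (F m))
    (hρa : ρ (FreeGroup.of 0) = FreeGroup.of 0 * FreeGroup.of 1)
    (hρ : ∀ i : Fin (m + 2), i ≠ 0 → ρ (FreeGroup.of i) = FreeGroup.of i) :
    ∀ ψ : MulAut (F m), ψ ∈ Subgroup.centralizer {ρ} →
      (Hsub m).map ψ.toMonoidHom = Hsub m := by
  intro ψ hψ
  have hcomm : ∀ x, ρ (ψ x) = ψ (ρ x) := fun x =>
    DFunLike.congr_fun (Subgroup.mem_centralizer_singleton_iff.1 hψ).symm x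
  ext y
  obtain ⟨x, rfl⟩ := ψ.surjective y
  refine (Subgroup.mem_map_iff_mem (f := ψ.toMonoidHom) ψ.injective).trans ?_
  rw [mem_Hsub_iff_fixed m ρ hρa hρ, mem_Hsub_iff_fixed m ρ hρa hρ, hcomm,
    ψ.injective.eq_iff]
end

section
/- Let φ be an automorphism of the subgroup H of F_n such that φ(b) is conjugate to b in H and φ(aba⁻¹) is conjugate to aba⁻¹ in H. Then there exists ψ ∈ Aut(F_n) commuting with the Nielsen automorphism ρ such that ψ(x) = φ(x) for every x ∈ H. -/
/-- `aba⁻¹` as an element of `H`. -/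
def abaH (m : ℕ) : Hsub m :=
  ⟨FreeGroup.of 0 * FreeGroup.of 1 * (FreeGroup.of 0)⁻¹,
    Subgroup.subset_closure (Set.mem_union_left _ (Set.mem_insert _ _))⟩

/-- `b` as an element of `H`. -/
def bH (m : ℕ) : Hsub m :=
  ⟨FreeGroup.of 1,
    Subgroup.subset_closure (Set.mem_union_left _ (Set.mem_insert_of_mem _ rfl))⟩

/-- Each basis element of `F m` other than `a = of 0` lies in `H`. -/
theorem of_mem_Hsub {m : ℕ} {i : Fin (m + 2)} (hi : i ≠ 0) : FreeGroup.of i ∈ Hsub m := by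
  rcases eq_or_ne i 1 with rfl | h1
  · exact (bH m).2
  · refine Subgroup.subset_closure (Or.inr ⟨i, ?_, rfl⟩)
    have h0 : (i : ℕ) ≠ 0 := fun h => hi (Fin.ext h)
    have h1' : (i : ℕ) ≠ 1 := fun h => h1 (Fin.ext (by simpa using h))
    omega

/-- Two homomorphisms out of `H` agree if they agree on `aba⁻¹`, `b` and the `cᵢ`. -/
theorem Hsub_hom_ext {m : ℕ} {G : Type*} [Group G] {f g : Hsub m →* G}
    (haba : f (abaH m) = g (abaH m))
    (hof : ∀ (i : Fin (m + 2)) (hi : i ≠ 0),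
      f ⟨FreeGroup.of i, of_mem_Hsub hi⟩ = g ⟨FreeGroup.of i, of_mem_Hsub hi⟩) :
    f = g := by
  ext ⟨x, hx⟩
  induction hx using Subgroup.closure_induction with
  | mem x hx =>
    rcases hx with (rfl | rfl) | ⟨j, hj, rfl⟩
    · exact haba
    · exact hof 1 (by simp)
    · exact hof j (by rintro rfl; simp at hj)
  | one => exact (map_one f).trans (map_one g).symm
  | mul x y hx hy ihx ihy =>
    exact (map_mul f ⟨x, hx⟩ ⟨y, hy⟩).trans
      ((congrArg₂ (· * ·) ihx ihy).trans (map_mul g ⟨x, hx⟩ ⟨y, hy⟩).symm)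
  | inv x hx ih =>
    exact (map_inv f ⟨x, hx⟩).trans ((congrArg (·⁻¹) ih).trans (map_inv g ⟨x, hx⟩).symm)

/-- An endomorphism `φ` of `H` with `φ(b) = hbh⁻¹` and `φ(aba⁻¹) = k(aba⁻¹)k⁻¹` extends to the
endomorphism of `F m` that sends `a` to `kah⁻¹`. -/
theorem exists_extend_hom {m : ℕ} (φ : Hsub m →* Hsub m) (h k : Hsub m)
    (hb : φ (bH m) = h * bH m * h⁻¹) (haba : φ (abaH m) = k * abaH m * k⁻¹) :
    ∃ ψ : F m →* F m, ψ (FreeGroup.of 0) = (k : F m) * FreeGroup.of 0 * (h : F m)⁻¹ ∧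
      ∀ x : Hsub m, ψ (x : F m) = ((φ x : Hsub m) : F m) := by
  let ψ : F m →* F m := FreeGroup.lift fun i =>
    if hi : i = 0 then (k : F m) * FreeGroup.of 0 * (h : F m)⁻¹ else φ ⟨FreeGroup.of i, of_mem_Hsub hi⟩
  have hψ0 : ψ (FreeGroup.of 0) = (k : F m) * FreeGroup.of 0 * (h : F m)⁻¹ := by simp [ψ]
  have hψ : ∀ (i : Fin (m + 2)) (hi : i ≠ 0),
      ψ (FreeGroup.of i) = φ ⟨FreeGroup.of i, of_mem_Hsub hi⟩ := fun i hi => by simp [ψ, hi]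
  have hψ1 : ψ (FreeGroup.of 1) = (h : F m) * FreeGroup.of 1 * (h : F m)⁻¹ :=
    (hψ 1 (by simp)).trans (congrArg Subtype.val hb)
  refine ⟨ψ, hψ0, DFunLike.congr_fun (f := ψ.comp (Hsub m).subtype)
    (g := (Hsub m).subtype.comp φ) (Hsub_hom_ext ?_ hψ)⟩
  have hφ : ((φ (abaH m) : Hsub m) : F m) =
      (k : F m) * (FreeGroup.of 0 * FreeGroup.of 1 * (FreeGroup.of 0)⁻¹) * (k : F m)⁻¹ :=
    congrArg Subtype.val haba
  change ψ (FreeGroup.of 0 * FreeGroup.of 1 * (FreeGroup.of 0)⁻¹) = φ (abaH m)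
  rw [hφ, map_mul, map_mul, map_inv, hψ0, hψ1]
  group

/-- Two endomorphisms of `F m` agree if they agree on `a` and on `H`. -/
theorem hom_ext_of_Hsub {m : ℕ} {G : Type*} [Group G] {f g : F m →* G}
    (h0 : f (FreeGroup.of 0) = g (FreeGroup.of 0)) (hH : ∀ x : Hsub m, f x = g x) : f = g := by
  refine FreeGroup.ext_hom _ _ fun i => ?_
  rcases eq_or_ne i 0 with rfl | hi
  · exact h0
  · exact hH ⟨_, of_mem_Hsub hi⟩

/-- The Nielsen automorphism `a ↦ ab` fixes `H` pointwise. -/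
theorem nielsen_fixes_Hsub {m : ℕ} (ρ : F m →* F m)
    (hρa : ρ (FreeGroup.of 0) = FreeGroup.of 0 * FreeGroup.of 1)
    (hρ : ∀ i : Fin (m + 2), i ≠ 0 → ρ (FreeGroup.of i) = FreeGroup.of i) (x : Hsub m) :
    ρ x = x := by
  refine DFunLike.congr_fun (f := ρ.comp (Hsub m).subtype) (g := (Hsub m).subtype)
    (Hsub_hom_ext ?_ hρ) x
  change ρ (FreeGroup.of 0 * FreeGroup.of 1 * (FreeGroup.of 0)⁻¹) =
    FreeGroup.of 0 * FreeGroup.of 1 * (FreeGroup.of 0)⁻¹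
  rw [map_mul, map_mul, map_inv, hρa, hρ 1 (by simp)]
  group

/-- if `φ` is an automorphism of `H = ⟨aba⁻¹, b, c₁, …, c_{n-2}⟩` such
that `φ(b)` is conjugate to `b` in `H` and `φ(aba⁻¹)` is conjugate to `aba⁻¹` in `H`,
then there is an automorphism `ψ` of `F_n` commuting with the Nielsen automorphism
`ρ : a ↦ ab, b ↦ b, cᵢ ↦ cᵢ` whose restriction to `H` is `φ`. -/
theorem extend_automorphism_of_H
    (m : ℕ) (ρ : MulAut (F m))
    (hρa : ρ (FreeGroup.of 0) = FreeGroup.of 0 * FreeGroup.of 1)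
    (hρ : ∀ i : Fin (m + 2), i ≠ 0 → ρ (FreeGroup.of i) = FreeGroup.of i)
    (φ : MulAut (Hsub m))
    (hb : IsConj (bH m) (φ (bH m)))
    (haba : IsConj (abaH m) (φ (abaH m))) :
    ∃ ψ : MulAut (F m), ψ * ρ = ρ * ψ ∧
      ∀ x : Hsub m, ψ (x : F m) = ((φ x : Hsub m) : F m) := by
  obtain ⟨h, hh⟩ := isConj_iff.mp hb
  obtain ⟨k, hk⟩ := isConj_iff.mp haba
  have symm_conj : ∀ g x : Hsub m, g * x * g⁻¹ = φ x →
      φ.symm x = (φ.symm g)⁻¹ * x * (φ.symm g)⁻¹⁻¹ := fun g x hgx => by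
    apply φ.injective
    simp [← hgx, mul_assoc]
  obtain ⟨ψ, hψ0, hψ⟩ := exists_extend_hom φ.toMonoidHom h k hh.symm hk.symm
  obtain ⟨θ, hθ0, hθ⟩ := exists_extend_hom φ.symm.toMonoidHom (φ.symm h)⁻¹ (φ.symm k)⁻¹
    (symm_conj h _ hh) (symm_conj k _ hk)
  simp only [MulEquiv.toMonoidHom_eq_coe, MonoidHom.coe_coe] at hψ hθ
  have hθψ : θ.comp ψ = MonoidHom.id _ := by
    refine hom_ext_of_Hsub ?_ fun x => ?_
    · simp [hψ0, hθ0, hθ, mul_assoc]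
    · simp [hψ, hθ]
  have hψθ : ψ.comp θ = MonoidHom.id _ := by
    refine hom_ext_of_Hsub ?_ fun x => ?_
    · simp [hψ0, hθ0, hψ, mul_assoc]
    · simp [hψ, hθ]
  have hρH := nielsen_fixes_Hsub ρ.toMonoidHom hρa hρ
  have hψb : ψ (FreeGroup.of 1) = (h : F m) * FreeGroup.of 1 * (h : F m)⁻¹ :=
    (hψ (bH m)).trans (congrArg Subtype.val hh.symm)
  have hcomm : ψ.comp ρ.toMonoidHom = ρ.toMonoidHom.comp ψ := by
    simp only [MulEquiv.toMonoidHom_eq_coe, MonoidHom.coe_coe] at hρH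
    refine hom_ext_of_Hsub ?_ fun x => ?_
    · simp [hρa, hψ0, hψb, hρH, mul_assoc]
    · simp [hψ, hρH]
  exact ⟨MonoidHom.toMulEquiv ψ θ hθψ hψθ,
    MulEquiv.ext fun x => DFunLike.congr_fun hcomm x, hψ⟩
end

section
/- Let ψ ∈ Aut(F_n) commute with the Nielsen automorphism ρ and suppose ψ fixes every element of the subgroup H, i.e. ψ(aba⁻¹) = aba⁻¹, ψ(b) = b and ψ(c_i) = c_i for all i. Then ψ = ρ^k for some integer k. -/
theorem FreeGroup.mk_mem_zpowers_of_commute {α : Type*} [DecidableEq α] (x : α) :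
    ∀ L : List (α × Bool), FreeGroup.IsReduced L →
      Commute (FreeGroup.of x) (FreeGroup.mk L) →
      FreeGroup.mk L ∈ Subgroup.zpowers (FreeGroup.of x)
  | [], _, _ => Subgroup.one_mem _
  | (y, s) :: L, hL, h => by
    have hL' : FreeGroup.IsReduced L := hL.infix (List.suffix_cons _ _).isInfix
    by_cases hyx : y = x
    · subst hyx
      have hsplit : FreeGroup.mk ((y, s) :: L) = FreeGroup.mk [(y, s)] * FreeGroup.mk L := by
        rw [FreeGroup.mul_mk, List.singleton_append]
      have hletter : FreeGroup.mk [(y, s)] ∈ Subgroup.zpowers (FreeGroup.of y) := by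
        cases s with
        | true => exact Subgroup.mem_zpowers (FreeGroup.of y)
        | false => exact (Subgroup.zpowers _).inv_mem (Subgroup.mem_zpowers (FreeGroup.of y))
      have hcomm : Commute (FreeGroup.of y) (FreeGroup.mk [(y, s)]) := by
        obtain ⟨k, hk⟩ := hletter
        rw [← hk]
        exact (Commute.refl _).zpow_right k
      rw [hsplit] at h ⊢
      refine mul_mem hletter (FreeGroup.mk_mem_zpowers_of_commute y L hL' ?_)
      simpa only [inv_mul_cancel_left] using hcomm.inv_right.mul_right h
    · exfalso
      have hcons : FreeGroup.IsReduced ((x, true) :: (y, s) :: L) :=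
        FreeGroup.isReduced_cons_cons.2 ⟨fun e => absurd e.symm hyx, hL⟩
      have hreduce : FreeGroup.reduce ((y, s) :: L ++ [(x, true)]) = (x, true) :: (y, s) :: L := by
        rw [← hcons.reduce_eq]
        refine FreeGroup.reduce.sound ?_
        have := h.eq.symm
        rwa [FreeGroup.of, FreeGroup.mul_mk, FreeGroup.mul_mk] at this
      have hsub : ((x, true) :: (y, s) :: L).Sublist ((y, s) :: L ++ [(x, true)]) :=
        hreduce ▸ (FreeGroup.reduce.red (L := (y, s) :: L ++ [(x, true)])).sublist
      have heq := hsub.eq_of_length (by simp)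
      rw [List.cons_append, List.cons.injEq, Prod.mk.injEq] at heq
      exact hyx heq.1.1.symm

/-- The centralizer of a basis element of a free group is the cyclic subgroup it generates. -/
theorem FreeGroup.mem_zpowers_of_commute_of {α : Type*} {x : α} {g : FreeGroup α}
    (h : Commute (FreeGroup.of x) g) : g ∈ Subgroup.zpowers (FreeGroup.of x) := by
  classical
  rw [← FreeGroup.mk_toWord (x := g)] at h ⊢
  exact FreeGroup.mk_mem_zpowers_of_commute x _ FreeGroup.isReduced_toWord h

theorem MulAut.zpow_apply_eq_self {G : Type*} [Group G] {ρ : MulAut G} {g : G}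
    (h : ρ g = g) (k : ℤ) : (ρ ^ k) g = g :=
  (MulAction.stabilizer (MulAut G) g).zpow_mem (x := ρ) h k

theorem MulAut.zpow_apply_eq_mul_zpow {G : Type*} [Group G] {ρ : MulAut G} {a b : G}
    (ha : ρ a = a * b) (hb : ρ b = b) (k : ℤ) : (ρ ^ k) a = a * b ^ k := by
  induction k with
  | zero => simp
  | succ k ih =>
    rw [zpow_add_one, MulAut.mul_apply, ha, map_mul, ih, MulAut.zpow_apply_eq_self hb,
      zpow_add_one, mul_assoc]
  | pred k ih =>
    have ha' : ρ⁻¹ a = a * b⁻¹ := by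
      rw [MulAut.inv_apply, MulEquiv.symm_apply_eq, map_mul, map_inv, ha, hb, mul_inv_cancel_right]
    rw [zpow_sub_one, MulAut.mul_apply, ha', map_mul, map_inv, ih,
      MulAut.zpow_apply_eq_self hb, zpow_sub_one, mul_assoc]

/-- if `ψ ∈ Aut(F_n)` commutes with the Nielsen automorphism
`ρ : a ↦ ab, b ↦ b, cᵢ ↦ cᵢ` and fixes every element of the subgroup
`H = ⟨aba⁻¹, b, c₁, …, c_{n-2}⟩` (i.e. `ψ(aba⁻¹) = aba⁻¹`, `ψ(b) = b` and
`ψ(cᵢ) = cᵢ` for all `i`), then `ψ = ρ^k` for some integer `k`. -/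
theorem power_of_nielsen_of_fixes_H
    (m : ℕ) (ρ ψ : MulAut (F m))
    (hρa : ρ (FreeGroup.of 0) = FreeGroup.of 0 * FreeGroup.of 1)
    (hρ : ∀ i : Fin (m + 2), i ≠ 0 → ρ (FreeGroup.of i) = FreeGroup.of i)
    (hcomm : ψ * ρ = ρ * ψ)
    (haba : ψ (FreeGroup.of 0 * FreeGroup.of 1 * (FreeGroup.of 0)⁻¹) =
      FreeGroup.of 0 * FreeGroup.of 1 * (FreeGroup.of 0)⁻¹)
    (hb : ψ (FreeGroup.of 1) = FreeGroup.of 1)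
    (hc : ∀ i : Fin (m + 2), 2 ≤ (i : ℕ) → ψ (FreeGroup.of i) = FreeGroup.of i) :
    ∃ k : ℤ, ψ = ρ ^ k := by
  have hcomm_b : Commute (FreeGroup.of 1) ((FreeGroup.of 0)⁻¹ * ψ (FreeGroup.of 0)) := by
    rw [map_mul, map_mul, map_inv, hb, mul_inv_eq_iff_eq_mul] at haba
    rw [commute_iff_eq, mul_assoc, haba]
    group
  obtain ⟨k, hk⟩ := FreeGroup.mem_zpowers_of_commute_of hcomm_b
  have hρb : ρ (FreeGroup.of 1) = FreeGroup.of 1 := hρ 1 (by simp)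
  refine ⟨k, MulEquiv.toMonoidHom_injective (FreeGroup.ext_hom _ _ fun i => ?_)⟩
  change ψ (FreeGroup.of i) = (ρ ^ k) (FreeGroup.of i)
  by_cases h0 : i = 0
  · subst h0
    rw [MulAut.zpow_apply_eq_mul_zpow hρa hρb]
    exact (eq_inv_mul_iff_mul_eq.1 hk).symm
  · rw [MulAut.zpow_apply_eq_self (hρ i h0)]
    by_cases h1 : i = 1
    · rw [h1, hb]
    · refine hc i ?_
      have h0' : (i : ℕ) ≠ 0 := fun e => h0 (Fin.ext e)
      have h1' : (i : ℕ) ≠ 1 := fun e => h1 (Fin.ext e)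
      omega
end

section
/- In Aut(F_n) for n ≥ 4, the automorphisms α and β commute, and α is conjugate in Aut(F_n) both to αβ and to αβ⁻¹; that is, there exist ψ, ψ′ ∈ Aut(F_n) with ψαψ⁻¹ = αβ and ψ′αψ′⁻¹ = αβ⁻¹. -/
/-! The free group of rank `n = m + 4` has basis `{a, b, c, d, e₁, …, e_{n-4}}` where
`a = of 0`, `b = of 1`, `c = of 2`, `d = of 3` and `eᵢ = of (i + 3)`. -/

theorem FreeGroup.mulAut_ext {ι : Type*} {φ ψ : MulAut (FreeGroup ι)}
    (h : ∀ i, φ (FreeGroup.of i) = ψ (FreeGroup.of i)) : φ = ψ :=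
  MulEquiv.toMonoidHom_injective (FreeGroup.ext_hom _ _ h)

/-- The endomorphism of a free group sending the generator `i` to `i * g` and fixing the other
generators. -/
def FreeGroup.rightMulHom {ι : Type*} [DecidableEq ι] (i : ι) (g : FreeGroup ι) :
    FreeGroup ι →* FreeGroup ι :=
  FreeGroup.lift fun k => if k = i then FreeGroup.of i * g else FreeGroup.of k

/-- The Nielsen automorphism sending the generator `i` to `i * j⁻¹` and fixing the other
generators. -/
def FreeGroup.nielsen {ι : Type*} [DecidableEq ι] {i j : ι} (hij : j ≠ i) :
    MulAut (FreeGroup ι) :=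
  MonoidHom.toMulEquiv (FreeGroup.rightMulHom i (FreeGroup.of j)⁻¹)
    (FreeGroup.rightMulHom i (FreeGroup.of j))
    (by
      ext k
      by_cases hk : k = i <;> simp [FreeGroup.rightMulHom, hk, hij])
    (by
      ext k
      by_cases hk : k = i <;> simp [FreeGroup.rightMulHom, hk, hij])

theorem FreeGroup.nielsen_self {ι : Type*} [DecidableEq ι] {i j : ι} (hij : j ≠ i) :
    FreeGroup.nielsen hij (FreeGroup.of i) = FreeGroup.of i * (FreeGroup.of j)⁻¹ := by
  simp [FreeGroup.nielsen, FreeGroup.rightMulHom]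

theorem FreeGroup.nielsen_of_ne {ι : Type*} [DecidableEq ι] {i j : ι} (hij : j ≠ i)
    {k : ι} (hk : k ≠ i) :
    FreeGroup.nielsen hij (FreeGroup.of k) = FreeGroup.of k := by
  simp [FreeGroup.nielsen, FreeGroup.rightMulHom, hk]

/-- in `Aut(F_n)` for `n ≥ 4` (written `n = m + 4`), the automorphisms
`α : c ↦ cb, d ↦ db⁻¹` (fixing `a`, `b` and the `eᵢ`) and `β : a ↦ ab` (fixing
`b`, `c`, `d` and the `eᵢ`) commute, and `α` is conjugate in `Aut(F_n)` both to `αβ`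
and to `αβ⁻¹`. -/
theorem parallelogram_conjugations
    (m : ℕ) (α β : MulAut (FreeGroup (Fin (m + 4))))
    (hαc : α (FreeGroup.of 2) = FreeGroup.of 2 * FreeGroup.of 1)
    (hαd : α (FreeGroup.of 3) = FreeGroup.of 3 * (FreeGroup.of 1)⁻¹)
    (hα : ∀ i : Fin (m + 4), i ≠ 2 → i ≠ 3 → α (FreeGroup.of i) = FreeGroup.of i)
    (hβa : β (FreeGroup.of 0) = FreeGroup.of 0 * FreeGroup.of 1)
    (hβ : ∀ i : Fin (m + 4), i ≠ 0 → β (FreeGroup.of i) = FreeGroup.of i) :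
    α * β = β * α ∧
    (∃ ψ : MulAut (FreeGroup (Fin (m + 4))), ψ * α * ψ⁻¹ = α * β) ∧
    (∃ ψ' : MulAut (FreeGroup (Fin (m + 4))), ψ' * α * ψ'⁻¹ = α * β⁻¹) := by
  have v2 : 2 % (m + 4) = 2 := Nat.mod_eq_of_lt (by omega)
  have v3 : 3 % (m + 4) = 3 := Nat.mod_eq_of_lt (by omega)
  have h10 : (1 : Fin (m + 4)) ≠ 0 := by simp
  have h20 : (2 : Fin (m + 4)) ≠ 0 := by simp [Fin.ext_iff, v2]
  have h30 : (3 : Fin (m + 4)) ≠ 0 := by simp [Fin.ext_iff, v3]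
  have h12 : (1 : Fin (m + 4)) ≠ 2 := by simp [Fin.ext_iff, v2]
  have h13 : (1 : Fin (m + 4)) ≠ 3 := by simp [Fin.ext_iff, v3]
  have hαa := hα 0 h20.symm h30.symm
  have hαb := hα 1 h12 h13
  have hβb := hβ 1 h10
  have hβc := hβ 2 h20
  have hβd := hβ 3 h30
  have hβa' : β⁻¹ (FreeGroup.of 0) = FreeGroup.of 0 * (FreeGroup.of 1)⁻¹ := by
    rw [MulAut.inv_apply, MulEquiv.symm_apply_eq]
    simp [hβa, hβb]
  have hβ' : ∀ i : Fin (m + 4), i ≠ 0 → β⁻¹ (FreeGroup.of i) = FreeGroup.of i := by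
    intro i hi
    rw [MulAut.inv_apply, MulEquiv.symm_apply_eq, hβ i hi]
  have hβc' := hβ' 2 h20
  have hβd' := hβ' 3 h30
  refine ⟨?_, ⟨FreeGroup.nielsen h20, ?_⟩, ⟨FreeGroup.nielsen h30, ?_⟩⟩
  · refine FreeGroup.mulAut_ext fun i => ?_
    simp only [MulAut.mul_apply]
    rcases eq_or_ne i 0 with rfl | h0
    · simp only [hβa, hαa, hαb, map_mul]
    rcases eq_or_ne i 2 with rfl | h2
    · simp only [hβb, hβc, hαc, map_mul]
    rcases eq_or_ne i 3 with rfl | h3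
    · simp only [hβb, hβd, hαd, map_mul, map_inv]
    simp only [hβ i h0, hα i h2 h3]
  · have ψa := FreeGroup.nielsen_self h20
    have ψb := FreeGroup.nielsen_of_ne h20 h10
    have ψc := FreeGroup.nielsen_of_ne h20 h20
    have ψd := FreeGroup.nielsen_of_ne h20 h30
    rw [mul_inv_eq_iff_eq_mul]
    refine FreeGroup.mulAut_ext fun i => ?_
    simp only [MulAut.mul_apply]
    rcases eq_or_ne i 0 with rfl | h0
    · simp only [ψa, hαa, hαb, hαc, hβa, hβc, map_mul, map_inv]
      group
    rcases eq_or_ne i 2 with rfl | h2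
    · simp only [ψb, ψc, hβc, hαc, map_mul]
    rcases eq_or_ne i 3 with rfl | h3
    · simp only [ψb, ψd, hβd, hαd, map_mul, map_inv]
    simp only [FreeGroup.nielsen_of_ne h20 h0, hβ i h0, hα i h2 h3]
  · have ψa := FreeGroup.nielsen_self h30
    have ψb := FreeGroup.nielsen_of_ne h30 h10
    have ψc := FreeGroup.nielsen_of_ne h30 h20
    have ψd := FreeGroup.nielsen_of_ne h30 h30
    rw [mul_inv_eq_iff_eq_mul]
    refine FreeGroup.mulAut_ext fun i => ?_
    simp only [MulAut.mul_apply]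
    rcases eq_or_ne i 0 with rfl | h0
    · simp only [ψa, hαa, hαb, hαd, hβa', hβd', map_mul, map_inv]
      group
    rcases eq_or_ne i 2 with rfl | h2
    · simp only [ψb, ψc, hβc', hαc, map_mul]
    rcases eq_or_ne i 3 with rfl | h3
    · simp only [ψb, ψd, hβd', hαd, map_mul, map_inv]
    simp only [FreeGroup.nielsen_of_ne h30 h0, hβ' i h0, hα i h2 h3]
end
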